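/- Let L be an infinite order polynomially complete lattice. Then: (a) μ_∞(L) is a strong limit cardinal; (b) μ(L) = μ_∞(L); (c) |L| = μ(L); (d) ν(L) = |L|. -/

import Mathlib

universe u v w

open Cardinal

/-- A well-ordered chain: a chain whose induced strict order is well-founded. -/
def IsWellChain {L : Type u} [PartialOrder L] (A : Set L) : Prop :=
  IsChain (· ≤ ·) A ∧ A.WellFoundedOn (· < ·)

/-- A co-well-ordered chain: a chain well-ordered under the reverse order. -/
def IsCoWellChain {L : Type u} [PartialOrder L] (A : Set L) : Prop :=
  IsChain (· ≤ ·) A ∧ A.WellFoundedOn (· > ·)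

/-- A subset of a partial order is uniform if it is an antichain, a well-ordered chain,
or a co-well-ordered chain. -/
def IsUniform {L : Type u} [PartialOrder L] (A : Set L) : Prop :=
  IsAntichain (· ≤ ·) A ∨ IsWellChain A ∨ IsCoWellChain A

/-- `mu L` is the least cardinal `m` such that `L` has no uniform subset of cardinality `m`. -/
noncomputable def mu (L : Type u) [PartialOrder L] : Cardinal.{u} :=
  sInf {m : Cardinal.{u} | ¬ ∃ A : Set L, IsUniform A ∧ #A = m}

/-- `nu2 L₁ L₂` is the least cardinal `n` such that there is no family of `n` pairwise
incomparable monotone functions from `L₁` to `L₂` (functions ordered pointwise). -/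
noncomputable def nu2 (L₁ : Type u) (L₂ : Type v) [PartialOrder L₁] [PartialOrder L₂] :
    Cardinal.{max u v} :=
  sInf {n : Cardinal.{max u v} |
    ¬ ∃ S : Set (L₁ → L₂), (∀ f ∈ S, Monotone f) ∧ IsAntichain (· ≤ ·) S ∧ #S = n}

/-- `nu L = nu2 L L`. -/
noncomputable def nu (L : Type u) [PartialOrder L] : Cardinal.{u} := nu2 L L

/-- `muInf L = sup_{n} mu (Lⁿ)` for `n ≥ 1`. -/
noncomputable def muInf (L : Type u) [PartialOrder L] : Cardinal.{u} :=
  ⨆ n : ℕ, mu (Fin (n + 1) → L)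

/-- `nuInf L = sup_{n} nu (Lⁿ, L)` for `n ≥ 1`. -/
noncomputable def nuInf (L : Type u) [PartialOrder L] : Cardinal.{u} :=
  ⨆ n : ℕ, nu2 (Fin (n + 1) → L) L

/-- A function `(Fin n → L) → L` is a polynomial function if it lies in the smallest
sublattice of the function lattice containing all coordinate projections and all
constant functions. -/
def IsPolynomialFn (L : Type u) [Lattice L] (n : ℕ) (f : (Fin n → L) → L) : Prop :=
  f ∈ latticeClosure ({g : (Fin n → L) → L | ∃ i : Fin n, g = fun x => x i} ∪
    {g : (Fin n → L) → L | ∃ c : L, g = fun _ => c})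

/-- A lattice is order polynomially complete if for every `n ≥ 1` every monotone
`n`-ary function is a polynomial function. -/
def OPC (L : Type u) [Lattice L] : Prop :=
  ∀ n : ℕ, 1 ≤ n → ∀ f : (Fin n → L) → L, Monotone f → IsPolynomialFn L n f

/-- The three possible comparison types between distinct blocks of a canonical family. -/
inductive CompType : Type
  | lt
  | gt
  | incomp

/-- The relation on `L` associated to a comparison type. -/
def CompType.rel {L : Type u} [PartialOrder L] : CompType → L → L → Prop
  | .lt, a, b => a < b
  | .gt, a, b => b < a
  | .incomp, a, b => ¬ a ≤ b ∧ ¬ b ≤ a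

/-- A family of subsets of `L` is canonical if each member is uniform, all members are
of the same type, and comparison between elements of distinct members depends only on
the pair of indices. -/
def IsCanonical {L : Type u} [PartialOrder L] {ι : Type v} (A : ι → Set L) : Prop :=
  ((∀ i, IsAntichain (· ≤ ·) (A i)) ∨ (∀ i, IsWellChain (A i)) ∨ (∀ i, IsCoWellChain (A i))) ∧
  ∃ F : ι → ι → CompType, ∀ i j, i ≠ j → ∀ a ∈ A i, ∀ b ∈ A j, (F i j).rel a b


/-- Lattice terms in `n` variables with anonymous parameter slots. -/
inductive PTerm (n : ℕ) : Type
  | var (i : Fin n)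
  | par
  | sup (a b : PTerm n)
  | inf (a b : PTerm n)

namespace PTerm

/-- An injective coding of terms by natural numbers. -/
def code {n : ℕ} : PTerm n → ℕ
  | var i => Nat.pair 0 i
  | par => Nat.pair 1 0
  | sup a b => Nat.pair 2 (Nat.pair a.code b.code)
  | inf a b => Nat.pair 3 (Nat.pair a.code b.code)

theorem code_injective {n : ℕ} : Function.Injective (code : PTerm n → ℕ) := by
  intro s
  induction s with
  | var i => intro t h; cases t <;> simp [code, Nat.pair_eq_pair, Fin.ext_iff] at h ⊢; exact h
  | par => intro t h; cases t <;> simp [code, Nat.pair_eq_pair] at h ⊢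
  | sup a b iha ihb =>
    intro t h
    cases t <;> simp [code, Nat.pair_eq_pair] at h ⊢
    exact ⟨iha h.1, ihb h.2⟩
  | inf a b iha ihb =>
    intro t h
    cases t <;> simp [code, Nat.pair_eq_pair] at h ⊢
    exact ⟨iha h.1, ihb h.2⟩

instance (n : ℕ) : Countable (PTerm n) := code_injective.countable

/-- Number of parameter slots. -/
def slots {n : ℕ} : PTerm n → ℕ
  | var _ => 0
  | par => 1
  | sup a b => a.slots + b.slots
  | inf a b => a.slots + b.slots

/-- Evaluation of a term. -/
def eval {n : ℕ} {L : Type u} [Lattice L] : (t : PTerm n) → (Fin t.slots → L) → (Fin n → L) → L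
  | var i, _, x => x i
  | par, c, _ => c (0 : Fin 1)
  | sup a b, c, x => a.eval (fun j => c (Fin.castAdd b.slots j)) x ⊔
      b.eval (fun j => c (Fin.natAdd a.slots j)) x
  | inf a b, c, x => a.eval (fun j => c (Fin.castAdd b.slots j)) x ⊓
      b.eval (fun j => c (Fin.natAdd a.slots j)) x

theorem eval_mono {n : ℕ} {L : Type u} [Lattice L] (t : PTerm n) :
    Monotone (t.eval : (Fin t.slots → L) → (Fin n → L) → L) := by
  induction t with
  | var i => intro c d _ x; exact le_rfl
  | par => intro c d h x; exact h (0 : Fin 1)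
  | sup a b iha ihb =>
    intro c d h x
    exact sup_le_sup (iha (fun j => h _) x) (ihb (fun j => h _) x)
  | inf a b iha ihb =>
    intro c d h x
    exact inf_le_inf (iha (fun j => h _) x) (ihb (fun j => h _) x)

end PTerm

theorem IsPolynomialFn.exists_eval {L : Type u} [Lattice L] {n : ℕ} {f : (Fin n → L) → L}
    (hf : IsPolynomialFn L n f) : ∃ t : PTerm n, ∃ c : Fin t.slots → L, t.eval c = f := by
  refine latticeClosure_sup_inf_induction
    (p := fun f _ => ∃ t : PTerm n, ∃ c : Fin t.slots → L, t.eval c = f) ?_ ?_ ?_ hf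
  · rintro g (⟨i, rfl⟩ | ⟨c, rfl⟩)
    · exact ⟨.var i, fun j => j.elim0, rfl⟩
    · exact ⟨.par, fun _ => c, rfl⟩
  · rintro _ - _ - ⟨a, c, rfl⟩ ⟨b, d, rfl⟩
    refine ⟨.sup a b, Fin.append c d, ?_⟩
    funext x
    simp [PTerm.eval]
  · rintro _ - _ - ⟨a, c, rfl⟩ ⟨b, d, rfl⟩
    refine ⟨.inf a b, Fin.append c d, ?_⟩
    funext x
    simp [PTerm.eval]

theorem poly_bdd_or {L : Type u} [Lattice L] {f : (Fin 1 → L) → L}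
    (hf : IsPolynomialFn L 1 f) : (∃ c, ∀ x, f x ≤ c) ∨ ∀ x, x 0 ≤ f x := by
  refine latticeClosure_sup_inf_induction
    (p := fun f _ => (∃ c, ∀ x, f x ≤ c) ∨ ∀ x, x 0 ≤ f x) ?_ ?_ ?_ hf
  · rintro g (⟨i, rfl⟩ | ⟨c, rfl⟩)
    · right; intro x; rw [Subsingleton.elim i 0]
    · left; exact ⟨c, fun _ => le_rfl⟩
  · rintro a - b - (⟨c, hc⟩ | ha) (⟨d, hd⟩ | hb)
    · exact Or.inl ⟨c ⊔ d, fun x => sup_le_sup (hc x) (hd x)⟩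
    · exact Or.inr fun x => (hb x).trans le_sup_right
    · exact Or.inr fun x => (ha x).trans le_sup_left
    · exact Or.inr fun x => (ha x).trans le_sup_left
  · rintro a - b - (⟨c, hc⟩ | ha) (⟨d, hd⟩ | hb)
    · exact Or.inl ⟨c, fun x => inf_le_left.trans (hc x)⟩
    · exact Or.inl ⟨c, fun x => inf_le_left.trans (hc x)⟩
    · exact Or.inl ⟨d, fun x => inf_le_right.trans (hd x)⟩
    · exact Or.inr fun x => le_inf (ha x) (hb x)

theorem poly_bdd_or' {L : Type u} [Lattice L] {f : (Fin 1 → L) → L}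
    (hf : IsPolynomialFn L 1 f) : (∃ c, ∀ x, c ≤ f x) ∨ ∀ x, f x ≤ x 0 := by
  refine latticeClosure_sup_inf_induction
    (p := fun f _ => (∃ c, ∀ x, c ≤ f x) ∨ ∀ x, f x ≤ x 0) ?_ ?_ ?_ hf
  · rintro g (⟨i, rfl⟩ | ⟨c, rfl⟩)
    · right; intro x; rw [Subsingleton.elim i 0]
    · left; exact ⟨c, fun _ => le_rfl⟩
  · rintro a - b - (⟨c, hc⟩ | ha) (⟨d, hd⟩ | hb)
    · exact Or.inl ⟨c, fun x => (hc x).trans le_sup_left⟩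
    · exact Or.inl ⟨c, fun x => (hc x).trans le_sup_left⟩
    · exact Or.inl ⟨d, fun x => (hd x).trans le_sup_right⟩
    · exact Or.inr fun x => sup_le (ha x) (hb x)
  · rintro a - b - (⟨c, hc⟩ | ha) (⟨d, hd⟩ | hb)
    · exact Or.inl ⟨c ⊓ d, fun x => inf_le_inf (hc x) (hd x)⟩
    · exact Or.inr fun x => inf_le_right.trans (hb x)
    · exact Or.inr fun x => inf_le_left.trans (ha x)
    · exact Or.inr fun x => inf_le_left.trans (ha x)

theorem exists_lt_of_infinite (L : Type u) [Lattice L] [Infinite L] : ∃ a b : L, a < b := by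
  obtain ⟨a, b, hab⟩ := exists_pair_ne L
  by_cases h : a ≤ b
  · exact ⟨a, b, lt_of_le_of_ne h hab⟩
  · exact ⟨b, a ⊔ b, lt_of_le_of_ne le_sup_right fun e => h (by rw [e]; exact le_sup_left)⟩

theorem OPC.exists_top {L : Type u} [Lattice L] [Infinite L] (h : OPC L) :
    ∃ t : L, ∀ x, x ≤ t := by
  classical
  by_contra! hno
  obtain ⟨a, c, hac⟩ := exists_lt_of_infinite L
  let f : (Fin 1 → L) → L := fun x => if x 0 ≤ c then a else x 0 ⊔ a
  have hf : Monotone f := by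
    intro x y hxy
    have h0 := hxy 0
    by_cases hx : x 0 ≤ c
    · by_cases hy : y 0 ≤ c
      · simp [f, hx, hy]
      · simp [f, hx, hy]
    · have hy : ¬ y 0 ≤ c := fun hy => hx (h0.trans hy)
      simp only [f, hx, hy, if_false]
      exact sup_le_sup_right h0 a
  rcases poly_bdd_or (h 1 le_rfl f hf) with ⟨d, hd⟩ | hx
  · obtain ⟨e, he⟩ := hno (c ⊔ d)
    have h1 : ¬ e ≤ c := fun h1 => he (h1.trans le_sup_left)
    have := hd (fun _ => e)
    simp only [f, h1, if_false] at this
    exact he ((le_sup_left.trans this).trans le_sup_right)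
  · have := hx (fun _ => c)
    simp only [f, le_refl, if_true] at this
    exact absurd hac (not_lt_of_ge this)

theorem OPC.exists_bot {L : Type u} [Lattice L] [Infinite L] (h : OPC L) :
    ∃ t : L, ∀ x, t ≤ x := by
  classical
  by_contra! hno
  obtain ⟨c, a, hac⟩ := exists_lt_of_infinite L
  let f : (Fin 1 → L) → L := fun x => if c ≤ x 0 then a else x 0 ⊓ a
  have hf : Monotone f := by
    intro x y hxy
    have h0 := hxy 0
    by_cases hy : c ≤ y 0
    · by_cases hx : c ≤ x 0
      · simp [f, hx, hy]
      · simp [f, hx, hy]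
    · have hx : ¬ c ≤ x 0 := fun hx => hy (hx.trans h0)
      simp only [f, hx, hy, if_false]
      exact inf_le_inf_right a h0
  rcases poly_bdd_or' (h 1 le_rfl f hf) with ⟨d, hd⟩ | hx
  · obtain ⟨e, he⟩ := hno (c ⊓ d)
    have h1 : ¬ c ≤ e := fun h1 => he (inf_le_left.trans h1)
    have := hd (fun _ => e)
    simp only [f, h1, if_false] at this
    exact he (inf_le_right.trans (this.trans inf_le_left))
  · have := hx (fun _ => c)
    simp only [f, le_refl, if_true] at this
    exact absurd hac (not_lt_of_ge this)

/-- There are at most `|L|` monotone functions on `Lⁿ`. -/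
theorem OPC.mk_mono_le {L : Type u} [Lattice L] [Infinite L] (h : OPC L) {n : ℕ} (hn : 1 ≤ n) :
    #{f : (Fin n → L) → L // Monotone f} ≤ #L := by
  have key : ∀ f : {f : (Fin n → L) → L // Monotone f},
      ∃ p : Σ t : PTerm n, (Fin t.slots → L), p.1.eval p.2 = f.1 := fun f => by
    obtain ⟨t, c, hc⟩ := (h n hn f.1 f.2).exists_eval
    exact ⟨⟨t, c⟩, hc⟩
  choose p hp using key
  have hinj : Function.Injective p := fun f g hfg => Subtype.ext (by rw [← hp f, ← hp g, hfg])
  refine (mk_le_of_injective hinj).trans ?_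
  have hL : ℵ₀ ≤ #L := aleph0_le_mk L
  rw [mk_sigma]
  refine (sum_le_lift_mk_mul_iSup _).trans ?_
  refine mul_le_of_le hL ?_ ?_
  · refine le_trans ?_ hL
    rw [lift_le_aleph0]
    exact mk_le_aleph0
  · refine ciSup_le' fun t => ?_
    rw [mk_arrow]
    simpa using power_nat_le (n := t.slots) hL

/-- An antichain of monotone functions gives an antichain in some power of `L`. -/
theorem OPC.antichain_of_functions {L : Type u} [Lattice L] (h : OPC L) {n : ℕ}
    (hn : 1 ≤ n) {S : Set ((Fin n → L) → L)} (hm : ∀ f ∈ S, Monotone f)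
    (hS : IsAntichain (· ≤ ·) S) (h1 : ℵ₀ ≤ #S) (h2 : ℵ₀ < (#S).ord.cof) :
    ∃ k : ℕ, ∃ A : Set (Fin (k + 1) → L), IsAntichain (· ≤ ·) A ∧ #A = #S := by
  have key : ∀ f : S, ∃ p : Σ t : PTerm n, (Fin t.slots → L), p.1.eval p.2 = f.1 := fun f => by
    obtain ⟨t, c, hc⟩ := (h n hn f.1 (hm _ f.2)).exists_eval
    exact ⟨⟨t, c⟩, hc⟩
  choose p hp using key
  obtain ⟨⟨t⟩, ht⟩ := infinite_pigeonhole (fun f : S => (ULift.up (p f).1 : ULift.{u} (PTerm n)))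
    h1 (lt_of_le_of_lt mk_le_aleph0 h2)
  have hq : ∀ f : ((fun f : S => (ULift.up (p f).1 : ULift.{u} (PTerm n))) ⁻¹' {ULift.up t}),
      ∃ c : Fin t.slots → L, t.eval c = f.1.1 := by
    rintro ⟨f, hf⟩
    have : (p f).1 = t := congrArg ULift.down hf
    subst this
    exact ⟨(p f).2, hp f⟩
  choose q hq using hq
  have hle : ∀ f g, q f ≤ q g → f = g := by
    intro f g hfg
    have h3 : f.1.1 ≤ g.1.1 := by
      rw [← hq f, ← hq g]
      exact t.eval_mono hfg
    exact Subtype.ext (Subtype.ext (hS.eq f.1.2 g.1.2 h3))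
  have hinj : Function.Injective q := fun f g hfg => hle f g hfg.le
  have hA : IsAntichain (· ≤ ·) (Set.range q) := by
    rintro _ ⟨f, rfl⟩ _ ⟨g, rfl⟩ hne hfg
    exact hne (by rw [hle f g hfg])
  have hc : #(Set.range q) = #S := by rw [mk_range_eq q hinj, ht]
  rcases hk : t.slots with _ | k
  · exfalso
    have : Subsingleton (Fin t.slots → L) := by rw [hk]; infer_instance
    have h4 : #(Set.range q) ≤ 1 := le_one_iff_subsingleton.2 inferInstance
    rw [hc] at h4
    exact absurd (h1.trans h4) (not_le_of_gt one_lt_aleph0)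
  · refine ⟨k, ?_⟩
    rw [← hk]
    exact ⟨_, hA, hc⟩

theorem exists_antichain_sets (W : Type u) [Infinite W] :
    ∃ G : Set W → Set W, ∀ U V, G U ⊆ G V → U = V := by
  have : #(W ⊕ W) = #W := by simp
  obtain ⟨e⟩ := Cardinal.eq.1 this
  refine ⟨fun U => {w | (∃ a ∈ U, e (Sum.inl a) = w) ∨ (∃ a ∉ U, e (Sum.inr a) = w)}, ?_⟩
  intro U V hUV
  apply Set.Subset.antisymm
  · intro a ha
    rcases hUV (Or.inl ⟨a, ha, rfl⟩) with ⟨b, hb, hbe⟩ | ⟨b, hb, hbe⟩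
    · have := e.injective hbe
      simp only [Sum.inl.injEq] at this
      exact this ▸ hb
    · have := e.injective hbe
      simp at this
  · intro a ha
    by_contra hn
    rcases hUV (Or.inr ⟨a, hn, rfl⟩) with ⟨b, hb, hbe⟩ | ⟨b, hb, hbe⟩
    · have := e.injective hbe
      simp at this
    · have := e.injective hbe
      simp only [Sum.inr.injEq] at this
      exact hb (this ▸ ha)

/-- A family of functions reflecting inclusion of sets yields a large antichain. -/
theorem exists_antichain_of_reflect {W : Type u} [Infinite W] {Q : Type u} [PartialOrder Q]
    (F : Set W → Q) (hF : ∀ U V, F U ≤ F V → U ⊆ V) :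
    ∃ S : Set Q, S ⊆ Set.range F ∧ IsAntichain (· ≤ ·) S ∧ #S = 2 ^ #W := by
  obtain ⟨G, hG⟩ := exists_antichain_sets W
  have key : ∀ U V, F (G U) ≤ F (G V) → U = V := fun U V h => hG _ _ (hF _ _ h)
  refine ⟨Set.range fun U => F (G U), ?_, ?_, ?_⟩
  · rintro _ ⟨U, rfl⟩; exact ⟨_, rfl⟩
  · rintro _ ⟨U, rfl⟩ _ ⟨V, rfl⟩ hne hle
    exact hne (by rw [key U V hle])
  · rw [mk_range_eq _ (fun U V h => key U V h.le), mk_set]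

/-- Every function on an antichain extends to a monotone function. -/
theorem exists_mono_extend {P : Type u} [PartialOrder P] {L : Type v} [Lattice L] [BoundedOrder L]
    {D : Set P} (hD : IsAntichain (· ≤ ·) D) (c : D → L) :
    ∃ F : P → L, Monotone F ∧ ∀ d : D, F d = c d := by
  classical
  refine ⟨fun x => if h : x ∈ D then c ⟨x, h⟩ else if ∃ d ∈ D, d ≤ x then ⊤ else ⊥, ?_, ?_⟩
  · intro x y hxy
    by_cases hx : x ∈ D
    · by_cases hy : y ∈ D
      · have : x = y := hD.eq hx hy hxy
        subst this; exact le_rfl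
      · have : ∃ d ∈ D, d ≤ y := ⟨x, hx, hxy⟩
        simp [hy, this]
    · by_cases hx' : ∃ d ∈ D, d ≤ x
      · obtain ⟨d, hd, hdx⟩ := hx'
        have hy : y ∉ D := by
          intro hy
          have : d = y := hD.eq hd hy (hdx.trans hxy)
          subst this
          exact hx (le_antisymm hxy hdx ▸ hy)
        have : ∃ d ∈ D, d ≤ y := ⟨d, hd, hdx.trans hxy⟩
        simp [hy, this]
      · simp [hx, hx']
  · intro d; simp

theorem exists_functions_of_antichain {P L : Type u} [PartialOrder P] [Lattice L]
    [BoundedOrder L] [Nontrivial L] {D : Set P} (hD : IsAntichain (· ≤ ·) D) (hi : ℵ₀ ≤ #D) :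
    ∃ S : Set (P → L), (∀ f ∈ S, Monotone f) ∧ IsAntichain (· ≤ ·) S ∧ #S = 2 ^ #D := by
  classical
  have : Infinite D := infinite_iff.2 hi
  choose F hF hFe using fun U : Set D =>
    exists_mono_extend hD (fun d => if d ∈ U then (⊤ : L) else ⊥)
  obtain ⟨S, h1, h2, h3⟩ := exists_antichain_of_reflect F (by
    intro U V hUV d hd
    by_contra hn
    have := hUV d
    rw [hFe, hFe] at this
    simp [hd, hn] at this)
  refine ⟨S, fun f hf => ?_, h2, h3⟩
  obtain ⟨U, rfl⟩ := h1 hf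
  exact hF U

theorem exists_functions_of_strictMono {L : Type u} [Lattice L] [BoundedOrder L] {κ : Cardinal.{u}}
    (hi : ℵ₀ ≤ κ) (e : κ.ord.ToType → L) (he : StrictMono e) :
    ∃ S : Set (L → L), (∀ f ∈ S, Monotone f) ∧ IsAntichain (· ≤ ·) S ∧ #S = 2 ^ κ := by
  classical
  have := Cardinal.noMaxOrder hi
  have : Infinite κ.ord.ToType := infinite_iff.2 (by rw [mk_ord_toType]; exact hi)
  have wf : WellFounded ((· < ·) : κ.ord.ToType → κ.ord.ToType → Prop) := wellFounded_lt
  let m : (x : L) → (∃ i, ¬ e i ≤ x) → κ.ord.ToType := fun x h => wf.min {i | ¬ e i ≤ x} h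
  have hm : ∀ x h, ¬ e (m x h) ≤ x := fun x h => wf.min_mem {i | ¬ e i ≤ x} h
  have hm' : ∀ x h i, i < m x h → e i ≤ x := fun x h i hi => by
    by_contra hn
    exact wf.not_lt_min {i | ¬ e i ≤ x} hn hi
  let F : Set κ.ord.ToType → L → L := fun U x =>
    if h : ∃ i, ¬ e i ≤ x then
      if ∃ j ∈ U, m x h = Order.succ j then e (m x h) else x ⊓ e (m x h)
    else ⊤
  have hle : ∀ U x h, F U x ≤ e (m x h) := by
    intro U x h
    simp only [F, h, dif_pos]
    split_ifs
    · exact le_rfl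
    · exact inf_le_right
  have hge : ∀ U x h, x ⊓ e (m x h) ≤ F U x := by
    intro U x h
    simp only [F, h, dif_pos]
    split_ifs
    · exact inf_le_right
    · exact le_rfl
  have hF : ∀ U, Monotone (F U) := by
    intro U x y hxy
    by_cases hy : ∃ i, ¬ e i ≤ y
    · have hx : ∃ i, ¬ e i ≤ x := hy.imp fun i hi h => hi (h.trans hxy)
      rcases lt_trichotomy (m x hx) (m y hy) with hlt | heq | hgt
      · exact (hle U x hx).trans ((le_inf (hm' y hy _ hlt) (he.monotone hlt.le)).trans (hge U y hy))
      · simp only [F, hx, hy, dif_pos, heq]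
        split_ifs
        · exact le_rfl
        · exact inf_le_inf_right _ hxy
      · exact absurd ((hm' x hx _ hgt).trans hxy) (hm y hy)
    · have : F U y = ⊤ := by simp only [F, hy]; simp
      rw [this]; exact le_top
  have hex : ∀ j, ∃ i, ¬ e i ≤ e j := fun j =>
    ⟨Order.succ j, not_le_of_gt (he (Order.lt_succ j))⟩
  have hms : ∀ j, m (e j) (hex j) = Order.succ j := by
    intro j
    apply le_antisymm
    · by_contra hn
      have := hm' _ (hex j) _ (lt_of_not_ge hn)
      exact absurd this (not_le_of_gt (he (Order.lt_succ j)))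
    · apply Order.succ_le_of_lt
      by_contra hn
      exact hm _ (hex j) (he.monotone (le_of_not_gt hn))
  obtain ⟨S, h1, h2, h3⟩ := exists_antichain_of_reflect F (by
    intro U V hUV j hj
    by_contra hn
    have h4 := hUV (e j)
    have h5 : ∃ j' ∈ U, Order.succ j = Order.succ j' := ⟨j, hj, rfl⟩
    have h6 : ¬ ∃ j' ∈ V, Order.succ j = Order.succ j' := by
      rintro ⟨j', hj', h⟩
      rw [Order.succ_eq_succ_iff] at h
      exact hn (h ▸ hj')
    simp only [F, hex j, dif_pos, hms, h5, h6, if_true, if_false] at h4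
    exact absurd (h4.trans inf_le_left) (not_le_of_gt (he (Order.lt_succ j))))
  refine ⟨S, fun f hf => ?_, h2, by rw [h3, mk_ord_toType]⟩
  obtain ⟨U, rfl⟩ := h1 hf
  exact hF U

theorem exists_functions_of_strictAnti {L : Type u} [Lattice L] [BoundedOrder L] {κ : Cardinal.{u}}
    (hi : ℵ₀ ≤ κ) (e : κ.ord.ToType → L) (he : StrictAnti e) :
    ∃ S : Set (L → L), (∀ f ∈ S, Monotone f) ∧ IsAntichain (· ≤ ·) S ∧ #S = 2 ^ κ := by
  let e' : κ.ord.ToType → Lᵒᵈ := fun i => OrderDual.toDual (e i)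
  have he' : StrictMono e' := fun i j hij => he hij
  obtain ⟨S, h1, h2, h3⟩ := exists_functions_of_strictMono hi e' he'
  refine ⟨S, fun f hf => ?_, fun f hf g hg hne hle => ?_, h3⟩
  · intro x y hxy
    exact h1 f hf (show OrderDual.toDual y ≤ OrderDual.toDual x from hxy)
  · exact h2 hg hf hne.symm hle

theorem wembed {X : Type u} (r : X → X → Prop) [IsWellOrder X r] {κ : Cardinal.{u}}
    (h : #X = κ) : ∃ e : κ.ord.ToType → X, ∀ i j, i < j → r (e i) (e j) := by
  have h1 := ord_le_type r
  rw [h, ← Ordinal.type_toType κ.ord, Ordinal.type_le_iff'] at h1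
  obtain ⟨e⟩ := h1
  exact ⟨e, fun i j hij => e.map_rel_iff.2 hij⟩

theorem finite_pigeonhole {W : Type u} {α : Type} [Finite α] (hW : ℵ₀ ≤ #W) (f : W → α) :
    ∃ a, #(f ⁻¹' {a}) = #W := by
  obtain ⟨⟨a⟩, ha⟩ := infinite_pigeonhole (fun w => (ULift.up (f w) : ULift.{u} α)) hW
    (lt_of_lt_of_le (lt_aleph0_of_finite _)
      (Ordinal.aleph0_le_cof_iff.2 (Ordinal.one_lt_cof_iff.2 (isSuccLimit_ord hW))))
  refine ⟨a, ?_⟩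
  rw [← ha]
  congr 2
  ext w
  simp [ULift.ext_iff]

theorem proj_strictMono {L : Type u} [PartialOrder L] {n : ℕ} {κ : Cardinal.{u}}
    (hi : ℵ₀ ≤ κ) (e : κ.ord.ToType → (Fin n → L)) (he : StrictMono e) :
    ∃ e' : κ.ord.ToType → L, StrictMono e' := by
  have := Cardinal.noMaxOrder hi
  have key : ∀ j, ∃ i, e j i < e (Order.succ j) i := fun j => by
    have := he (Order.lt_succ j)
    exact (Pi.lt_def.1 this).2
  choose p hp using key
  obtain ⟨i, hi'⟩ := finite_pigeonhole (by rw [mk_ord_toType]; exact hi) p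
  rw [mk_ord_toType] at hi'
  obtain ⟨g, hg⟩ := wembed (X := p ⁻¹' {i}) (· < ·) hi'
  refine ⟨fun j => e (g j) i, fun a b hab => ?_⟩
  have h1 : (g a).1 < (g b).1 := hg a b hab
  have h2 : p (g a) = i := (g a).2
  have h3 := hp (g a).1
  rw [h2] at h3
  exact lt_of_lt_of_le h3 (he.monotone (Order.succ_le_of_lt h1) i)

theorem IsWellChain.exists_strictMono {P : Type u} [PartialOrder P] {A : Set P}
    (h : IsWellChain A) {κ : Cardinal.{u}} (hc : #A = κ) :
    ∃ e : κ.ord.ToType → P, StrictMono e := by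
  have : IsWellOrder A (fun a b => a.1 < b.1) :=
    { trichotomous := fun a b h1 h2 => by
        by_contra hne
        rcases h.1 a.2 b.2 (fun e => hne (Subtype.ext e)) with h3 | h3
        · exact h1 (lt_of_le_of_ne h3 (fun e => hne (Subtype.ext e)))
        · exact h2 (lt_of_le_of_ne h3 (fun e => hne (Subtype.ext e.symm)))
      wf := h.2 }
  obtain ⟨e, he⟩ := wembed (fun a b : A => a.1 < b.1) hc
  exact ⟨fun i => (e i).1, fun i j hij => he i j hij⟩

theorem IsCoWellChain.exists_strictAnti {P : Type u} [PartialOrder P] {A : Set P}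
    (h : IsCoWellChain A) {κ : Cardinal.{u}} (hc : #A = κ) :
    ∃ e : κ.ord.ToType → P, StrictAnti e :=
  IsWellChain.exists_strictMono (P := Pᵒᵈ) (A := A) ⟨fun _ ha _ hb hne => (h.1 ha hb hne).symm, h.2⟩ hc

/-- Unary functions as functions on `Fin 1 → L`. -/
theorem unary_family {L : Type u} [PartialOrder L] {κ : Cardinal.{u}} (S : Set (L → L))
    (h1 : ∀ f ∈ S, Monotone f) (h2 : IsAntichain (· ≤ ·) S) (h3 : #S = κ) :
    ∃ S : Set ((Fin 1 → L) → L), (∀ f ∈ S, Monotone f) ∧ IsAntichain (· ≤ ·) S ∧ #S = κ := by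
  let T : (L → L) → (Fin 1 → L) → L := fun f x => f (x 0)
  have hT : ∀ f g, T f ≤ T g → f ≤ g := fun f g hfg x => hfg (fun _ => x)
  refine ⟨T '' S, ?_, ?_, ?_⟩
  · rintro _ ⟨f, hf, rfl⟩ x y hxy
    exact h1 f hf (hxy 0)
  · rintro _ ⟨f, hf, rfl⟩ _ ⟨g, hg, rfl⟩ hne hle
    exact hne (by rw [h2.eq hf hg (hT _ _ hle)])
  · rw [mk_image_eq (fun f g hfg => le_antisymm (hT _ _ hfg.le) (hT _ _ hfg.ge)), h3]

/-- Passing from uniform sets to exponentially large antichains. -/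
theorem OPC.exp_antichain {L : Type u} [Lattice L] [Infinite L] [BoundedOrder L] (h : OPC L)
    {n : ℕ} {A : Set (Fin (n + 1) → L)} (hA : IsUniform A) (hi : ℵ₀ ≤ #A) :
    ∃ k : ℕ, ∃ B : Set (Fin (k + 1) → L), IsAntichain (· ≤ ·) B ∧ #B = 2 ^ #A := by
  have hc : ℵ₀ < ((2 : Cardinal.{u}) ^ #A).ord.cof :=
    lt_of_le_of_lt hi (lt_cof_ord_power hi one_lt_two)
  have hi2 : ℵ₀ ≤ (2 : Cardinal.{u}) ^ #A := hi.trans (cantor _).le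
  have fin : ∀ m : ℕ, 1 ≤ m → (∃ S : Set ((Fin m → L) → L), (∀ f ∈ S, Monotone f) ∧
      IsAntichain (· ≤ ·) S ∧ #S = 2 ^ #A) →
      ∃ k : ℕ, ∃ B : Set (Fin (k + 1) → L), IsAntichain (· ≤ ·) B ∧ #B = 2 ^ #A := by
    rintro m hm ⟨S, h1, h2, h3⟩
    rw [← h3] at hc hi2 ⊢
    exact h.antichain_of_functions hm h1 h2 hi2 hc
  rcases hA with hA | hA | hA
  · exact fin (n + 1) (by omega) (exists_functions_of_antichain hA hi)
  · obtain ⟨e, he⟩ := hA.exists_strictMono rfl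
    obtain ⟨e', he'⟩ := proj_strictMono hi e he
    obtain ⟨S, h1, h2, h3⟩ := exists_functions_of_strictMono hi e' he'
    exact fin 1 le_rfl (unary_family S h1 h2 h3)
  · obtain ⟨e, he⟩ := hA.exists_strictAnti rfl
    obtain ⟨e', he'⟩ := proj_strictMono (L := Lᵒᵈ) hi (fun i j => OrderDual.toDual (e i j))
      (fun i j hij => by
        obtain ⟨h1, k, hk⟩ := Pi.lt_def.1 (he hij)
        exact Pi.lt_def.2 ⟨fun l => h1 l, k, hk⟩)
    obtain ⟨S, h1, h2, h3⟩ := exists_functions_of_strictAnti (L := L) hi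
      (fun i => OrderDual.ofDual (e' i)) (fun i j hij => he' hij)
    exact fin 1 le_rfl (unary_family S h1 h2 h3)

theorem isWellChain_range {W P : Type u} [LinearOrder W] [WellFoundedLT W] [PartialOrder P]
    {e : W → P} (he : StrictMono e) : IsWellChain (Set.range e) := by
  refine ⟨?_, ?_⟩
  · rintro _ ⟨i, rfl⟩ _ ⟨j, rfl⟩ -
    exact (le_total i j).imp (fun h => he.monotone h) (fun h => he.monotone h)
  · rw [Set.wellFoundedOn_range]
    refine Subrelation.wf (r := (· < ·)) ?_ wellFounded_lt
    intro i j hij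
    exact he.lt_iff_lt.1 hij

theorem isCoWellChain_range {W P : Type u} [LinearOrder W] [WellFoundedLT W] [PartialOrder P]
    {e : W → P} (he : StrictAnti e) : IsCoWellChain (Set.range e) := by
  refine ⟨?_, ?_⟩
  · rintro _ ⟨i, rfl⟩ _ ⟨j, rfl⟩ -
    exact (le_total j i).imp (fun h => he.antitone h) (fun h => he.antitone h)
  · rw [Set.wellFoundedOn_range]
    refine Subrelation.wf (r := (· < ·)) ?_ wellFounded_lt
    intro i j hij
    exact he.lt_iff_gt.1 hij

/-- Erdős–Rado style bound: a poset without uniform sets of size `κ` is small. -/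
theorem erdos_rado {L : Type u} [PartialOrder L] {κ : Cardinal.{u}} (hκ : ℵ₀ ≤ κ)
    (hno : ¬ ∃ A : Set L, IsUniform A ∧ #A = κ) :
    #L ≤ #(Σ i : κ.ord.ToType, (Set.Iio i → Bool × Bool)) := by
  classical
  rcases isEmpty_or_nonempty L with hL | ⟨⟨l₀⟩⟩
  · simp
  let col : L → L → Bool × Bool := fun a b => (decide (a < b), decide (b < a))
  let pick : Set L → L := fun S => if h : S.Nonempty then h.choose else l₀
  have hpick : ∀ S : Set L, S.Nonempty → pick S ∈ S := fun S h => by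
    simp only [pick, h, dif_pos]
    exact h.choose_spec
  have wf : WellFounded ((· < ·) : κ.ord.ToType → κ.ord.ToType → Prop) := wellFounded_lt
  have hg : ∃ g : L → κ.ord.ToType → L, ∀ x i,
      g x i = pick {y | ∀ j, j < i → g x j ≠ y ∧ col (g x j) y = col (g x j) x} := by
    refine ⟨fun x => wf.fix fun i prev =>
      pick {y | ∀ j (h : j < i), prev j h ≠ y ∧ col (prev j h) y = col (prev j h) x}, ?_⟩
    intro x i
    exact wf.fix_eq _ i
  obtain ⟨g, hg⟩ := hg
  by_cases hx : ∃ x, ∀ i, g x i ≠ x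
  · exfalso
    obtain ⟨x, hx⟩ := hx
    have hmem : ∀ i j, j < i → g x j ≠ g x i ∧ col (g x j) (g x i) = col (g x j) x := by
      intro i
      have := hpick {y | ∀ j, j < i → g x j ≠ y ∧ col (g x j) y = col (g x j) x}
        ⟨x, fun j _ => ⟨hx j, rfl⟩⟩
      rw [← hg] at this
      exact this
    obtain ⟨q, hq⟩ := finite_pigeonhole (by rw [mk_ord_toType]; exact hκ)
      (fun i => col (g x i) x)
    rw [mk_ord_toType] at hq
    let e : ((fun i => col (g x i) x) ⁻¹' {q}) → L := fun i => g x i.1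
    have hcol : ∀ i j, i < j → e i ≠ e j ∧ col (e i) (e j) = q := by
      intro i j hij
      have h1 := hmem j.1 i.1 hij
      exact ⟨h1.1, h1.2.trans i.2⟩
    have hinj : Function.Injective e := by
      intro i j hij
      rcases lt_trichotomy i j with h | h | h
      · exact absurd hij (hcol i j h).1
      · exact h
      · exact absurd hij.symm (hcol j i h).1
    apply hno
    refine ⟨Set.range e, ?_, by rw [mk_range_eq e hinj, hq]⟩
    obtain ⟨q1, q2⟩ := q
    simp only [col, Prod.mk.injEq] at hcol
    rcases q1 with _ | _
    · rcases q2 with _ | _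
      · left
        have hn : ∀ i j, i < j → ¬ e i ≤ e j ∧ ¬ e j ≤ e i := by
          intro i j hij
          obtain ⟨h1, h2, h3⟩ := hcol i j hij
          simp only [decide_eq_false_iff_not] at h2 h3
          exact ⟨fun h => h2 (lt_of_le_of_ne h h1), fun h => h3 (lt_of_le_of_ne h h1.symm)⟩
        rintro _ ⟨i, rfl⟩ _ ⟨j, rfl⟩ hne hle
        rcases lt_trichotomy i j with h | h | h
        · exact (hn i j h).1 hle
        · exact hne (by rw [h])
        · exact (hn j i h).2 hle
      · right; right
        exact isCoWellChain_range fun i j hij => by simpa using (hcol i j hij).2.2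
    · right; left
      exact isWellChain_range fun i j hij => by simpa using (hcol i j hij).2.1
  · push Not at hx
    choose i hi using hx
    refine mk_le_of_injective
      (f := fun x => (⟨i x, fun j => col (g x j.1) x⟩ :
        Σ i : κ.ord.ToType, (Set.Iio i → Bool × Bool))) ?_
    intro x y hxy
    simp only [Sigma.mk.injEq] at hxy
    obtain ⟨h1, h2⟩ := hxy
    have h3 : ∀ j, j < i x → col (g x j) x = col (g y j) y := by
      have aux : ∀ (a b : κ.ord.ToType) (u : Set.Iio a → Bool × Bool) (v : Set.Iio b → Bool × Bool),
          a = b → u ≍ v → ∀ j (ha : j < a) (hb : j < b), u ⟨j, ha⟩ = v ⟨j, hb⟩ := by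
        rintro a b u v rfl h j ha hb
        rw [eq_of_heq h]
      intro j hj
      exact aux _ _ _ _ h1 h2 j hj (h1 ▸ hj)
    have h4 : ∀ j, j ≤ i x → g x j = g y j := by
      intro j
      induction j using wf.induction with
      | _ j ih =>
        intro hj
        rw [hg x j, hg y j]
        congr 1
        ext z
        simp only [Set.mem_setOf_eq]
        refine forall_congr' fun k => forall_congr' fun hk => ?_
        rw [h3 k (lt_of_lt_of_le hk hj), ih k hk (hk.le.trans hj)]
    have h5 := h4 (i x) le_rfl
    rw [hi x, h1, hi y] at h5
    exact h5

theorem erdos_rado_pow {L : Type u} [PartialOrder L] {κ : Cardinal.{u}} (hκ : ℵ₀ ≤ κ)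
    (hno : ¬ ∃ A : Set L, IsUniform A ∧ #A = κ) : #L ≤ 2 ^ κ := by
  refine (erdos_rado hκ hno).trans ?_
  rw [mk_sigma]
  refine (sum_le_mk_mul_iSup _).trans ?_
  have h2 : ℵ₀ ≤ (2 : Cardinal.{u}) ^ κ := hκ.trans (cantor _).le
  refine mul_le_of_le h2 ?_ ?_
  · rw [mk_ord_toType]; exact (cantor _).le
  · refine ciSup_le' fun i => ?_
    have h4 : (4 : Cardinal.{u}) = 2 * 2 := by norm_num
    have : #(Set.Iio i) ≤ κ := (mk_set_le _).trans (mk_ord_toType κ).le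
    simp only [mk_arrow, lift_uzero, mk_prod, lift_id, mk_bool, lift_mul, lift_ofNat]
    rw [mul_power]
    have h5 : (2 : Cardinal.{u}) ^ #(Set.Iio i) ≤ 2 ^ κ := power_le_power_left two_ne_zero this
    exact mul_le_of_le h2 h5 h5

theorem erdos_rado_strongLimit {L : Type u} [PartialOrder L] {κ : Cardinal.{u}} (hκ : ℵ₀ ≤ κ)
    (hs : κ.IsStrongLimit) (hno : ¬ ∃ A : Set L, IsUniform A ∧ #A = κ) : #L ≤ κ := by
  refine (erdos_rado hκ hno).trans ?_
  rw [mk_sigma]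
  refine (sum_le_mk_mul_iSup _).trans ?_
  refine mul_le_of_le hκ ?_ ?_
  · rw [mk_ord_toType]
  · refine ciSup_le' fun i => ?_
    have : #(Set.Iio i) < κ := mk_Iio_toType_ord_lt i
    simp only [mk_arrow, lift_uzero, mk_prod, lift_id, mk_bool, lift_mul, lift_ofNat]
    rw [mul_power]
    have h5 : (2 : Cardinal.{u}) ^ #(Set.Iio i) ≤ κ := (hs.isStrongPrelimit this).le
    exact mul_le_of_le hκ h5 h5

theorem IsUniform.subset {P : Type u} [PartialOrder P] {A B : Set P} (h : IsUniform A)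
    (hB : B ⊆ A) : IsUniform B := by
  rcases h with h | h | h
  · exact Or.inl (h.subset hB)
  · exact Or.inr (Or.inl ⟨h.1.mono hB, h.2.subset hB⟩)
  · exact Or.inr (Or.inr ⟨h.1.mono hB, h.2.subset hB⟩)

theorem lt_mu_iff {P : Type u} [PartialOrder P] {κ : Cardinal.{u}} :
    κ < mu P ↔ ∃ A : Set P, IsUniform A ∧ #A = κ := by
  constructor
  · intro h
    have := notMem_of_lt_csInf' h
    simpa using this
  · rintro ⟨A, hA, hc⟩
    by_contra hn
    have hn := le_of_not_gt hn
    have hne : {m : Cardinal.{u} | ¬ ∃ A : Set P, IsUniform A ∧ #A = m}.Nonempty := by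
      refine ⟨2 ^ #P, ?_⟩
      rintro ⟨B, -, hB⟩
      have h1 := mk_set_le B
      rw [hB] at h1
      exact absurd h1 (not_le_of_gt (cantor _))
    have hmem : mu P ∈ {m : Cardinal.{u} | ¬ ∃ A : Set P, IsUniform A ∧ #A = m} := csInf_mem hne
    rw [← hc, le_mk_iff_exists_subset] at hn
    obtain ⟨B, hB, hBc⟩ := hn
    exact hmem ⟨B, hA.subset hB, hBc⟩

theorem lt_muInf_iff {L : Type u} [PartialOrder L] {κ : Cardinal.{u}} :
    κ < muInf L ↔ ∃ n : ℕ, κ < mu (Fin (n + 1) → L) :=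
  lt_ciSup_iff bddAbove_of_small

theorem exists_uniform_aleph0 (P : Type u) [PartialOrder P] [Infinite P] :
    ∃ A : Set P, IsUniform A ∧ #A = ℵ₀ := by
  suffices h : ∃ f : ℕ → P, Function.Injective f ∧ IsUniform (Set.range f) by
    obtain ⟨f, hf, hu⟩ := h
    refine ⟨_, hu, ?_⟩
    have := mk_range_eq_of_injective hf
    simpa using this
  let f := Infinite.natEmbedding P
  have hsm : ∀ e : ℕ → P, StrictMono e → IsWellChain (Set.range e) := by
    intro e he
    refine ⟨?_, ?_⟩
    · rintro _ ⟨i, rfl⟩ _ ⟨j, rfl⟩ -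
      exact (le_total i j).imp (fun h => he.monotone h) (fun h => he.monotone h)
    · rw [Set.wellFoundedOn_range]
      refine Subrelation.wf (r := (· < ·)) ?_ wellFounded_lt
      intro i j hij
      exact he.lt_iff_lt.1 hij
  have hsa : ∀ e : ℕ → P, StrictAnti e → IsCoWellChain (Set.range e) := by
    intro e he
    refine ⟨?_, ?_⟩
    · rintro _ ⟨i, rfl⟩ _ ⟨j, rfl⟩ -
      exact (le_total j i).imp (fun h => he.antitone h) (fun h => he.antitone h)
    · rw [Set.wellFoundedOn_range]
      refine Subrelation.wf (r := (· < ·)) ?_ wellFounded_lt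
      intro i j hij
      exact he.lt_iff_gt.1 hij
  obtain ⟨g, hg | hg⟩ := exists_increasing_or_nonincreasing_subseq ((· < ·) : P → P → Prop) f
  · exact ⟨fun n => f (g n), f.injective.comp g.injective,
      Or.inr (Or.inl (hsm _ fun m n h => hg m n h))⟩
  obtain ⟨k, hk | hk⟩ := exists_increasing_or_nonincreasing_subseq ((· > ·) : P → P → Prop)
    (fun n => f (g n))
  · exact ⟨fun n => f (g (k n)), f.injective.comp (g.injective.comp k.injective),
      Or.inr (Or.inr (hsa _ fun m n h => hk m n h))⟩
  have hinj : Function.Injective fun n => f (g (k n)) :=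
    f.injective.comp (g.injective.comp k.injective)
  refine ⟨fun n => f (g (k n)), hinj, Or.inl ?_⟩
  rintro _ ⟨i, rfl⟩ _ ⟨j, rfl⟩ hne hle
  have hlt := lt_of_le_of_ne hle hne
  rcases lt_trichotomy i j with h | h | h
  · exact hg _ _ (k.lt_iff_lt.2 h) hlt
  · exact hne (by rw [h])
  · exact hk _ _ h hlt

theorem mu_le_muInf (L : Type u) [PartialOrder L] : mu L ≤ muInf L := by
  refine le_of_forall_lt fun κ hκ => ?_
  obtain ⟨A, hA, hc⟩ := lt_mu_iff.1 hκ
  refine lt_muInf_iff.2 ⟨0, lt_mu_iff.2 ⟨(fun x : Fin 1 → L => x 0) ⁻¹' A, ?_, ?_⟩⟩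
  · have hle : ∀ x y : Fin 1 → L, x ≤ y ↔ x 0 ≤ y 0 := fun x y => by
      simp [Pi.le_def]
    have hlt : ∀ x y : Fin 1 → L, x < y ↔ x 0 < y 0 := fun x y => by
      simp [lt_iff_le_not_ge, hle]
    have hne : ∀ x y : Fin 1 → L, x ≠ y → x 0 ≠ y 0 := fun x y h h' => h (by
      funext i; rw [Subsingleton.elim i 0]; exact h')
    rcases hA with h | h | h
    · exact Or.inl fun x hx y hy hxy hl => h hx hy (hne _ _ hxy) ((hle _ _).1 hl)
    · refine Or.inr (Or.inl ⟨fun x hx y hy hxy => ?_, ?_⟩)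
      · exact (h.1 hx hy (hne _ _ hxy)).imp (hle _ _).2 (hle _ _).2
      · refine Subrelation.wf ?_ (InvImage.wf
          (fun x : ((fun x : Fin 1 → L => x 0) ⁻¹' A) => (⟨x.1 0, x.2⟩ : A)) h.2)
        intro x y hxy
        exact (hlt _ _).1 hxy
    · refine Or.inr (Or.inr ⟨fun x hx y hy hxy => ?_, ?_⟩)
      · exact (h.1 hx hy (hne _ _ hxy)).imp (hle _ _).2 (hle _ _).2
      · refine Subrelation.wf ?_ (InvImage.wf
          (fun x : ((fun x : Fin 1 → L => x 0) ⁻¹' A) => (⟨x.1 0, x.2⟩ : A)) h.2)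
        intro x y hxy
        exact (hlt _ _).1 hxy
  · rw [← hc]
    exact mk_preimage_equiv (Equiv.funUnique (Fin 1) L) A

theorem OPC.strongLimit {L : Type u} [Lattice L] [Infinite L] [BoundedOrder L] (h : OPC L) :
    (muInf L).IsStrongLimit := by
  have h0 : ℵ₀ < muInf L := (lt_mu_iff.2 (exists_uniform_aleph0 L)).trans_le (mu_le_muInf L)
  refine ⟨(aleph0_pos.trans h0).ne', fun κ hκ => ?_⟩
  rcases lt_or_ge κ ℵ₀ with hf | hi
  · exact (power_lt_aleph0 (natCast_lt_aleph0 (n := 2)) hf).trans h0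
  · obtain ⟨n, hn⟩ := lt_muInf_iff.1 hκ
    obtain ⟨A, hA, hc⟩ := lt_mu_iff.1 hn
    rw [← hc] at hi ⊢
    obtain ⟨k, B, hB, hBc⟩ := h.exp_antichain hA hi
    exact lt_muInf_iff.2 ⟨k, lt_mu_iff.2 ⟨B, Or.inl hB, hBc⟩⟩

theorem OPC.aleph0_lt_cof {L : Type u} [Lattice L] [Infinite L] [BoundedOrder L] (h : OPC L) :
    ℵ₀ < (#L).ord.cof := by
  obtain ⟨A, hA, hAc⟩ := exists_uniform_aleph0 (Fin 1 → L)
  obtain ⟨k, B, hB, hBc⟩ := h.exp_antichain (n := 0) hA hAc.ge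
  have hle : ℵ₀ ≤ #B := by rw [hBc, hAc]; exact (cantor _).le
  have h1 : #L ^ #B ≤ #L := by
    choose F hF hFe using fun c : B → L => exists_mono_extend hB c
    rw [show #L ^ #B = #(B → L) by simp]
    refine le_trans (mk_le_of_injective
      (f := fun c => (⟨F c, hF c⟩ : {f : (Fin (k + 1) → L) → L // Monotone f})) ?_)
      (h.mk_mono_le (by omega))
    intro c d hcd
    funext b
    rw [← hFe c, ← hFe d]
    exact congrFun (congrArg Subtype.val hcd) b
  by_contra hn
  have hL : ℵ₀ ≤ #L := aleph0_le_mk L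
  have h2 := lt_power_cof_ord hL
  have h3 : #L ^ (#L).ord.cof ≤ #L ^ #B :=
    power_le_power_left (mk_ne_zero L) ((le_of_not_gt hn).trans hle)
  exact absurd (h3.trans h1) (not_le_of_gt h2)

theorem OPC.main {L : Type u} [Lattice L] [Infinite L] [BoundedOrder L] (h : OPC L) :
    (muInf L).IsStrongLimit ∧ mu L = muInf L ∧ #L = mu L ∧ nu L = #L := by
  have hs := h.strongLimit
  have h0 : ℵ₀ < mu L := lt_mu_iff.2 (exists_uniform_aleph0 L)
  have hL : ℵ₀ ≤ #L := aleph0_le_mk L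
  have hML : muInf L ≤ #L := by
    refine le_of_forall_lt fun κ hκ => ?_
    obtain ⟨n, hn⟩ := lt_muInf_iff.1 (hs.isStrongPrelimit hκ)
    obtain ⟨A, -, hc⟩ := lt_mu_iff.1 hn
    refine (cantor κ).trans_le ?_
    rw [← hc]
    refine (mk_set_le A).trans ?_
    rw [mk_arrow]
    have := power_nat_le (n := n + 1) hL
    rw [← power_natCast] at this
    simpa using this
  have hno : ¬ ∃ A : Set L, IsUniform A ∧ #A = mu L := fun hA =>
    lt_irrefl _ (lt_mu_iff.2 hA)
  have hmu : mu L = muInf L := by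
    refine (mu_le_muInf L).antisymm ?_
    by_contra hn
    have h1 := erdos_rado_pow h0.le hno
    have h2 := hs.isStrongPrelimit (lt_of_not_ge hn)
    exact absurd (hML.trans h1) (not_le_of_gt h2)
  have hcard : #L = mu L :=
    le_antisymm (erdos_rado_strongLimit h0.le (hmu ▸ hs) hno) (hmu ▸ hML)
  refine ⟨hs, hmu, hcard, ?_⟩
  have hmem : #L ∈ {n : Cardinal.{u} | ¬ ∃ S : Set (L → L), (∀ f ∈ S, Monotone f) ∧
      IsAntichain (· ≤ ·) S ∧ #S = n} := by
    rintro ⟨S, h1, h2, h3⟩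
    obtain ⟨T, h1, h2, h3⟩ := unary_family S h1 h2 h3
    obtain ⟨k, A, hA, hAc⟩ := h.antichain_of_functions le_rfl h1 h2 (h3 ▸ hL)
      (h3 ▸ h.aleph0_lt_cof)
    have : #L < muInf L := lt_muInf_iff.2 ⟨k, lt_mu_iff.2 ⟨A, Or.inl hA, hAc.trans h3⟩⟩
    exact absurd hML (not_le_of_gt this)
  apply le_antisymm
  · exact csInf_le' hmem
  · refine le_csInf ⟨_, hmem⟩ fun κ hκ => ?_
    by_contra hlt
    apply hκ
    have hlt := lt_of_not_ge hlt
    have h1 : max κ ℵ₀ < mu L := max_lt (hcard ▸ hlt) h0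
    obtain ⟨A, hA, hc⟩ := lt_mu_iff.1 h1
    have hi : ℵ₀ ≤ #A := hc ▸ le_max_right _ _
    have : ∃ S : Set (L → L), (∀ f ∈ S, Monotone f) ∧ IsAntichain (· ≤ ·) S ∧ #S = 2 ^ #A := by
      rcases hA with hA | hA | hA
      · exact exists_functions_of_antichain hA hi
      · obtain ⟨e, he⟩ := hA.exists_strictMono rfl
        exact exists_functions_of_strictMono hi e he
      · obtain ⟨e, he⟩ := hA.exists_strictAnti rfl
        exact exists_functions_of_strictAnti hi e he
    obtain ⟨S, hm, ha, hS⟩ := this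
    have h2 : κ ≤ #S := by
      rw [hS]
      exact ((le_max_left _ _).trans hc.ge).trans (cantor _).le
    obtain ⟨T, hT, hTc⟩ := le_mk_iff_exists_subset.1 h2
    exact ⟨T, fun f hf => hm f (hT hf), ha.subset hT, hTc⟩

/-- For an infinite o.p.c. lattice `L`: `μ_∞(L)` is a strong limit cardinal,
`μ(L) = μ_∞(L)`, `|L| = μ(L)`, and `ν(L) = |L|`. -/
theorem opc_conclusion (L : Type u) [Lattice L] [Infinite L] (h : OPC L) :
    (muInf L).IsStrongLimit ∧ mu L = muInf L ∧ #L = mu L ∧ nu L = #L := by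
  obtain ⟨t, ht⟩ := h.exists_top
  obtain ⟨b, hb⟩ := h.exists_bot
  letI : BoundedOrder L := { top := t, bot := b, le_top := ht, bot_le := hb }
  exact h.main
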